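/- arXiv:2309.00379 — 7 statements merged into one kernel-verified Lean document; each statement's English description precedes it below -/
import Mathlib

section
/- Let ℓ₊, ℓ₋ : ℝ → ℝ be nonnegative functions satisfying ℓ₋(t) − ℓ₊(t) ≥ −b₁|t| and ℓ₋(t) ≥ b₂(b₃ − |t|) for all t ∈ ℝ, where b₁, b₂, b₃ > 0. Let a ∈ (0,1), π_p, π_n ≥ 0, let g : ℝ^d → ℝ, let x₁ᵘ,…,x_{n_u}ᵘ, x₁ᵖ,…,x_{n_p}ᵖ, x₁ⁿ,…,x_{n_n}ⁿ be points of ℝ^d, and let r ∈ ℝ satisfy r ≥ ((1−a)·b₂ + a·b₁)·(π_n/n_n)·Σᵢ |g(xᵢⁿ)| − (1−a)·π_n·b₂·b₃. Then the regularized objective (a/n_u)·Σᵢ ℓ₊(g(xᵢᵘ)) + ((1−a)·π_p/n_p)·Σᵢ ℓ₊(g(xᵢᵖ)) + (π_n/n_n)·Σᵢ ℓ₋(g(xᵢⁿ)) − (a·π_n/n_n)·Σᵢ ℓ₊(g(xᵢⁿ)) + r is nonnegative. -/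
open Finset

/-- nonnegativity of the regularized empirical risk (12) of the shallow
semi-supervised anomaly detection method, Theorem 1(ii) of the paper. -/
theorem shallow_rAD_objective_nonneg
    {d : ℕ} (ℓp ℓm : ℝ → ℝ)
    (hℓp_nonneg : ∀ t : ℝ, 0 ≤ ℓp t) (hℓm_nonneg : ∀ t : ℝ, 0 ≤ ℓm t)
    (b1 b2 b3 : ℝ) (hb1 : 0 < b1) (hb2 : 0 < b2) (hb3 : 0 < b3)
    (hdiff : ∀ t : ℝ, ℓm t - ℓp t ≥ -b1 * |t|)
    (hlow : ∀ t : ℝ, ℓm t ≥ b2 * (b3 - |t|))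
    (a : ℝ) (ha : 0 < a) (ha' : a < 1)
    (πp πn : ℝ) (hπp : 0 ≤ πp) (hπn : 0 ≤ πn)
    (g : (Fin d → ℝ) → ℝ)
    (nu np nn : ℕ) (hnu : 1 ≤ nu) (hnp : 1 ≤ np) (hnn : 1 ≤ nn)
    (xu : Fin nu → (Fin d → ℝ)) (xp : Fin np → (Fin d → ℝ)) (xn : Fin nn → (Fin d → ℝ))
    (r : ℝ)
    (hr : r ≥ ((1 - a) * b2 + a * b1) * ((πn / nn) * ∑ i, |g (xn i)|)
            - (1 - a) * πn * b2 * b3) :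
    0 ≤ (a / nu) * ∑ i, ℓp (g (xu i))
        + ((1 - a) * πp / np) * ∑ i, ℓp (g (xp i))
        + (πn / nn) * ∑ i, ℓm (g (xn i))
        - (a * πn / nn) * ∑ i, ℓp (g (xn i))
        + r := by
  have hnn0 : (nn : ℝ) ≠ 0 := by positivity
  have hu : 0 ≤ (a / nu) * ∑ i, ℓp (g (xu i)) :=
    mul_nonneg (by positivity) (Finset.sum_nonneg fun i _ => hℓp_nonneg _)
  have hp : 0 ≤ ((1 - a) * πp / np) * ∑ i, ℓp (g (xp i)) :=
    mul_nonneg (div_nonneg (mul_nonneg (by linarith) hπp) (by positivity))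
      (Finset.sum_nonneg fun i _ => hℓp_nonneg _)
  have hsum : (1 - a) * b2 * b3 * nn - ((1 - a) * b2 + a * b1) * ∑ i, |g (xn i)|
      ≤ ∑ i, ℓm (g (xn i)) - a * ∑ i, ℓp (g (xn i)) := by
    have h : ∑ i, ((1 - a) * b2 * b3 - ((1 - a) * b2 + a * b1) * |g (xn i)|)
        ≤ ∑ i, (ℓm (g (xn i)) - a * ℓp (g (xn i))) := by
      refine Finset.sum_le_sum fun i _ => ?_
      have h1 := mul_le_mul_of_nonneg_left (hdiff (g (xn i))) ha.le
      have h2 := mul_le_mul_of_nonneg_left (hlow (g (xn i))) (sub_nonneg.2 ha'.le)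
      linarith
    simp only [Finset.sum_sub_distrib, ← Finset.mul_sum, Finset.sum_const, Finset.card_univ,
      Fintype.card_fin, nsmul_eq_mul] at h
    linarith
  have hn := mul_le_mul_of_nonneg_left hsum (by positivity : 0 ≤ πn / (nn : ℝ))
  have hcancel : πn / (nn : ℝ) * ((1 - a) * b2 * b3 * nn) = (1 - a) * πn * b2 * b3 := by
    field_simp
  have hassoc : a * πn / (nn : ℝ) = πn / nn * a := by ring
  rw [hassoc]
  linarith
end

section
/- Under the mixture assumption μ = π_p·μ_p + π_n·μ_n with π_p + π_n = 1, and assuming ℓ₊∘g is integrable with respect to μ_p and ℓ₋∘g is integrable with respect to both μ_p and μ_n, the risk satisfies the PU identity R(g) = π_p·(R_p⁺(g) − R_p⁻(g)) + R_u⁻(g), i.e. π_p·∫ℓ₊(g) dμ_p + π_n·∫ℓ₋(g) dμ_n = π_p·(∫ℓ₊(g) dμ_p − ∫ℓ₋(g) dμ_p) + ∫ℓ₋(g) dμ. -/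
open MeasureTheory

/-- the PU risk identity (4) of the paper,
R(g) = π_p·(R_p⁺(g) − R_p⁻(g)) + R_u⁻(g), under the mixture assumption
μ = π_p·μ_p + π_n·μ_n with π_p + π_n = 1. -/
theorem pu_risk_identity
    {d : ℕ} (μp μn : Measure (Fin d → ℝ))
    [IsProbabilityMeasure μp] [IsProbabilityMeasure μn]
    (πp πn : ℝ) (hπp : 0 ≤ πp) (hπn : 0 ≤ πn) (hsum : πp + πn = 1)
    (μ : Measure (Fin d → ℝ))
    (hμ : μ = ENNReal.ofReal πp • μp + ENNReal.ofReal πn • μn)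
    (ℓp ℓm : ℝ → ℝ) (hℓp : Measurable ℓp) (hℓm : Measurable ℓm)
    (g : (Fin d → ℝ) → ℝ) (hg : Measurable g)
    (hint_pp : Integrable (fun x => ℓp (g x)) μp)
    (hint_pm : Integrable (fun x => ℓm (g x)) μp)
    (hint_nm : Integrable (fun x => ℓm (g x)) μn) :
    πp * ∫ x, ℓp (g x) ∂μp + πn * ∫ x, ℓm (g x) ∂μn =
      πp * ((∫ x, ℓp (g x) ∂μp) - ∫ x, ℓm (g x) ∂μp) + ∫ x, ℓm (g x) ∂μ := by
  subst hμ
  rw [integral_add_measure (hint_pm.smul_measure ENNReal.ofReal_ne_top)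
      (hint_nm.smul_measure ENNReal.ofReal_ne_top),
    integral_smul_measure, integral_smul_measure, ENNReal.toReal_ofReal hπp,
    ENNReal.toReal_ofReal hπn, smul_eq_mul, smul_eq_mul]
  ring
end

section
/- Under the mixture assumption μ = π_p·μ_p + π_n·μ_n with π_p + π_n = 1, and assuming ℓ₊∘g is integrable with respect to both μ_p and μ_n and ℓ₋∘g is integrable with respect to μ_n, the risk satisfies the NU identity R(g) = −π_n·(R_n⁺(g) − R_n⁻(g)) + R_u⁺(g), i.e. π_p·∫ℓ₊(g) dμ_p + π_n·∫ℓ₋(g) dμ_n = −π_n·(∫ℓ₊(g) dμ_n − ∫ℓ₋(g) dμ_n) + ∫ℓ₊(g) dμ. -/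
open MeasureTheory

/-- the NU risk identity (5) of the paper,
R(g) = −π_n·(R_n⁺(g) − R_n⁻(g)) + R_u⁺(g), under the mixture assumption
μ = π_p·μ_p + π_n·μ_n with π_p + π_n = 1. -/
theorem nu_risk_identity
    {d : ℕ} (μp μn : Measure (Fin d → ℝ))
    [IsProbabilityMeasure μp] [IsProbabilityMeasure μn]
    (πp πn : ℝ) (hπp : 0 ≤ πp) (hπn : 0 ≤ πn) (hsum : πp + πn = 1)
    (μ : Measure (Fin d → ℝ))
    (hμ : μ = ENNReal.ofReal πp • μp + ENNReal.ofReal πn • μn)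
    (ℓp ℓm : ℝ → ℝ) (hℓp : Measurable ℓp) (hℓm : Measurable ℓm)
    (g : (Fin d → ℝ) → ℝ) (hg : Measurable g)
    (hint_pp : Integrable (fun x => ℓp (g x)) μp)
    (hint_np : Integrable (fun x => ℓp (g x)) μn)
    (hint_nm : Integrable (fun x => ℓm (g x)) μn) :
    πp * ∫ x, ℓp (g x) ∂μp + πn * ∫ x, ℓm (g x) ∂μn =
      -πn * ((∫ x, ℓp (g x) ∂μn) - ∫ x, ℓm (g x) ∂μn) + ∫ x, ℓp (g x) ∂μ := by
  rw [hμ, integral_add_measure (hint_pp.smul_measure ENNReal.ofReal_ne_top)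
    (hint_np.smul_measure ENNReal.ofReal_ne_top), integral_smul_measure, integral_smul_measure,
    ENNReal.toReal_ofReal hπp, ENNReal.toReal_ofReal hπn, smul_eq_mul, smul_eq_mul]
  ring
end

section
/- Under the mixture assumption μ = π_p·μ_p + π_n·μ_n with π_p + π_n = 1, and assuming ℓ₊∘g is integrable with respect to both μ_p and μ_n and ℓ₋∘g is integrable with respect to μ_n, for every a ∈ (0,1) the risk admits the convex-combination decomposition R(g) = a·R_u⁺(g) + (1−a)·π_p·R_p⁺(g) + π_n·R_n⁻(g) − a·π_n·R_n⁺(g), i.e. π_p·∫ℓ₊(g) dμ_p + π_n·∫ℓ₋(g) dμ_n = a·∫ℓ₊(g) dμ + (1−a)·π_p·∫ℓ₊(g) dμ_p + π_n·∫ℓ₋(g) dμ_n − a·π_n·∫ℓ₊(g) dμ_n. -/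
open MeasureTheory

/-- the convex-combination risk decomposition (9) of the paper,
R(g) = a·R_u⁺(g) + (1−a)·π_p·R_p⁺(g) + π_n·R_n⁻(g) − a·π_n·R_n⁺(g), under the
mixture assumption μ = π_p·μ_p + π_n·μ_n with π_p + π_n = 1, for every a ∈ (0,1). -/
theorem convex_combination_risk_decomposition
    {d : ℕ} (μp μn : Measure (Fin d → ℝ))
    [IsProbabilityMeasure μp] [IsProbabilityMeasure μn]
    (πp πn : ℝ) (hπp : 0 ≤ πp) (hπn : 0 ≤ πn) (hsum : πp + πn = 1)
    (μ : Measure (Fin d → ℝ))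
    (hμ : μ = ENNReal.ofReal πp • μp + ENNReal.ofReal πn • μn)
    (ℓp ℓm : ℝ → ℝ) (hℓp : Measurable ℓp) (hℓm : Measurable ℓm)
    (g : (Fin d → ℝ) → ℝ) (hg : Measurable g)
    (hint_pp : Integrable (fun x => ℓp (g x)) μp)
    (hint_np : Integrable (fun x => ℓp (g x)) μn)
    (hint_nm : Integrable (fun x => ℓm (g x)) μn)
    (a : ℝ) (ha : 0 < a) (ha' : a < 1) :
    πp * ∫ x, ℓp (g x) ∂μp + πn * ∫ x, ℓm (g x) ∂μn =
      a * ∫ x, ℓp (g x) ∂μ + (1 - a) * πp * ∫ x, ℓp (g x) ∂μp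
        + πn * ∫ x, ℓm (g x) ∂μn - a * πn * ∫ x, ℓp (g x) ∂μn := by
  have hmix : ∫ x, ℓp (g x) ∂μ = πp * ∫ x, ℓp (g x) ∂μp + πn * ∫ x, ℓp (g x) ∂μn := by
    rw [hμ, integral_add_measure (hint_pp.smul_measure ENNReal.ofReal_ne_top)
      (hint_np.smul_measure ENNReal.ofReal_ne_top), integral_smul_measure,
      integral_smul_measure, ENNReal.toReal_ofReal hπp, ENNReal.toReal_ofReal hπn,
      smul_eq_mul, smul_eq_mul]
  rw [hmix]
  ring
end

section
/- Suppose X₁ᵖ,…,X_{n_p}ᵖ, X₁ⁿ,…,X_{n_n}ⁿ, X₁ᵘ,…,X_{n_u}ᵘ are ℝ^d-valued random variables with each Xᵢᵖ distributed according to μ_p, each Xᵢⁿ according to μ_n, each Xᵢᵘ according to μ = π_p·μ_p + π_n·μ_n, and the compositions ℓ₊∘g, ℓ₋∘g are integrable with respect to μ_p, μ_n, and μ. Then for every a ∈ (0,1), the estimator R̂²_s(g) = a·(1/n_u)·Σᵢℓ₊(g(Xᵢᵘ)) + (1−a)·π_p·(1/n_p)·Σᵢℓ₊(g(Xᵢᵖ))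 + π_n·(1/n_n)·Σᵢℓ₋(g(Xᵢⁿ)) − a·π_n·(1/n_n)·Σᵢℓ₊(g(Xᵢⁿ)) is unbiased for the risk: E[R̂²_s(g)] = R(g). -/
open MeasureTheory Finset

/-- The empirical mean of an integrable `f` over a nonempty sample of identically distributed
points is integrable, and its expectation is the integral of `f` against their common law. -/
lemma integrable_empiricalMean_and_integral_eq {Ω E : Type*} [MeasurableSpace Ω]
    [MeasurableSpace E] {P : Measure Ω} {ν : Measure E} {f : E → ℝ} (hf : Integrable f ν)
    {n : ℕ} (hn : 0 < n) {X : Fin n → Ω → E} (hX : ∀ i, Measurable (X i))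
    (hlaw : ∀ i, Measure.map (X i) P = ν) :
    Integrable (fun ω => (1 / (n : ℝ)) * ∑ i, f (X i ω)) P ∧
      ∫ ω, (1 / (n : ℝ)) * ∑ i, f (X i ω) ∂P = ∫ x, f x ∂ν := by
  have hint : ∀ i, Integrable (fun ω => f (X i ω)) P := fun i =>
    ((hlaw i).symm ▸ hf : Integrable f (Measure.map (X i) P)).comp_measurable (hX i)
  have hval : ∀ i, ∫ ω, f (X i ω) ∂P = ∫ x, f x ∂ν := fun i => by
    have hfm : AEStronglyMeasurable f (Measure.map (X i) P) :=
      (hlaw i).symm ▸ hf.aestronglyMeasurable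
    rw [← integral_map (hX i).aemeasurable hfm, hlaw i]
  refine ⟨(integrable_finsetSum _ fun i _ => hint i).const_mul _, ?_⟩
  rw [integral_const_mul, integral_finsetSum _ fun i _ => hint i]
  have hn' : (n : ℝ) ≠ 0 := by exact_mod_cast hn.ne'
  simp only [hval, sum_const, card_univ, Fintype.card_fin, nsmul_eq_mul]
  field_simp

/-- the estimator R̂²ₛ(g) of (10) is an unbiased estimator of the risk
R(g) = π_p·∫ℓ₊(g) dμ_p + π_n·∫ℓ₋(g) dμ_n. -/
theorem rAD_estimator2_unbiased
    {d : ℕ} {Ω : Type*} [MeasurableSpace Ω] (P : Measure Ω) [IsProbabilityMeasure P]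
    (μp μn : Measure (Fin d → ℝ))
    [IsProbabilityMeasure μp] [IsProbabilityMeasure μn]
    (πp πn : ℝ) (hπp : 0 ≤ πp) (hπn : 0 ≤ πn) (hsum : πp + πn = 1)
    (μ : Measure (Fin d → ℝ))
    (hμ : μ = ENNReal.ofReal πp • μp + ENNReal.ofReal πn • μn)
    (ℓp ℓm : ℝ → ℝ) (hℓp : Measurable ℓp) (hℓm : Measurable ℓm)
    (g : (Fin d → ℝ) → ℝ) (hg : Measurable g)
    (np nn nu : ℕ) (hnp : 0 < np) (hnn : 0 < nn) (hnu : 0 < nu)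
    (Xp : Fin np → Ω → (Fin d → ℝ)) (Xn : Fin nn → Ω → (Fin d → ℝ))
    (Xu : Fin nu → Ω → (Fin d → ℝ))
    (hXpm : ∀ i, Measurable (Xp i)) (hXnm : ∀ i, Measurable (Xn i))
    (hXum : ∀ i, Measurable (Xu i))
    (hXp : ∀ i, Measure.map (Xp i) P = μp) (hXn : ∀ i, Measure.map (Xn i) P = μn)
    (hXu : ∀ i, Measure.map (Xu i) P = μ)
    (hint_pp : Integrable (fun x => ℓp (g x)) μp)
    (hint_pm : Integrable (fun x => ℓm (g x)) μp)
    (hint_np : Integrable (fun x => ℓp (g x)) μn)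
    (hint_nm : Integrable (fun x => ℓm (g x)) μn)
    (hint_up : Integrable (fun x => ℓp (g x)) μ)
    (hint_um : Integrable (fun x => ℓm (g x)) μ)
    (a : ℝ) (ha : 0 < a) (ha' : a < 1) :
    ∫ ω, (a * ((1 / (nu : ℝ)) * ∑ i, ℓp (g (Xu i ω)))
          + (1 - a) * πp * ((1 / (np : ℝ)) * ∑ i, ℓp (g (Xp i ω)))
          + πn * ((1 / (nn : ℝ)) * ∑ i, ℓm (g (Xn i ω)))
          - a * πn * ((1 / (nn : ℝ)) * ∑ i, ℓp (g (Xn i ω)))) ∂P =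
      πp * ∫ x, ℓp (g x) ∂μp + πn * ∫ x, ℓm (g x) ∂μn := by
  obtain ⟨iu, eu⟩ := integrable_empiricalMean_and_integral_eq hint_up hnu hXum hXu
  obtain ⟨ip, ep⟩ := integrable_empiricalMean_and_integral_eq hint_pp hnp hXpm hXp
  obtain ⟨im, em⟩ := integrable_empiricalMean_and_integral_eq hint_nm hnn hXnm hXn
  obtain ⟨iq, eq⟩ := integrable_empiricalMean_and_integral_eq hint_np hnn hXnm hXn
  have hmix : ∫ x, ℓp (g x) ∂μ = πp * ∫ x, ℓp (g x) ∂μp + πn * ∫ x, ℓp (g x) ∂μn := by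
    rw [hμ, integral_add_measure (hint_pp.smul_measure ENNReal.ofReal_ne_top)
      (hint_np.smul_measure ENNReal.ofReal_ne_top), integral_smul_measure, integral_smul_measure,
      ENNReal.toReal_ofReal hπp, ENNReal.toReal_ofReal hπn, smul_eq_mul, smul_eq_mul]
  rw [integral_sub (((iu.const_mul a).fun_add (ip.const_mul _)).fun_add (im.const_mul πn))
      (iq.const_mul _),
    integral_add ((iu.const_mul a).fun_add (ip.const_mul _)) (im.const_mul πn),
    integral_add (iu.const_mul a) (ip.const_mul _), integral_const_mul a,
    integral_const_mul ((1 - a) * πp), integral_const_mul πn, integral_const_mul (a * πn),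
    eu, ep, em, eq, hmix]
  ring
end

section
/- Suppose X₁ᵖ,…,X_{n_p}ᵖ, X₁ⁿ,…,X_{n_n}ⁿ, X₁ᵘ,…,X_{n_u}ᵘ are ℝ^d-valued random variables with each Xᵢᵖ distributed according to μ_p, each Xᵢⁿ according to μ_n, each Xᵢᵘ according to μ = π_p·μ_p + π_n·μ_n, and that ℓ₊∘g and ℓ₋∘g are integrable with respect to μ_p, μ_n, and μ. Then for every a ∈ (0,1), the nonnegative estimator R̂¹_s(g) = π_n·R̂_n⁻(g) + (1−a)·π_p·R̂_p⁺(g) + a·max{0, R̂_u⁺(g) − π_n·R̂_n⁺(g)} has nonnegative bias: E[R̂¹_s(g)] ≥ R(g). -/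
open MeasureTheory Finset

/-- The average of an integrable function over identically distributed samples is integrable. -/
theorem integrable_sample_mean {Ω E : Type*} [MeasurableSpace Ω] [MeasurableSpace E]
    {P : Measure Ω} {ν : Measure E} {n : ℕ} {X : Fin n → Ω → E} {f : E → ℝ}
    (hX : ∀ i, Measurable (X i)) (hmap : ∀ i, Measure.map (X i) P = ν) (hf : Integrable f ν) :
    Integrable (fun ω => (1 / (n : ℝ)) * ∑ i, f (X i ω)) P := by
  refine (integrable_finsetSum _ fun i _ => ?_).const_mul _
  rw [← hmap i] at hf
  exact hf.comp_measurable (hX i)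

/-- The average of an integrable function over identically distributed samples is an unbiased
estimator of its mean. -/
theorem integral_sample_mean {Ω E : Type*} [MeasurableSpace Ω] [MeasurableSpace E]
    {P : Measure Ω} {ν : Measure E} {n : ℕ} (hn : 0 < n) {X : Fin n → Ω → E} {f : E → ℝ}
    (hX : ∀ i, Measurable (X i)) (hmap : ∀ i, Measure.map (X i) P = ν) (hf : Integrable f ν) :
    ∫ ω, (1 / (n : ℝ)) * ∑ i, f (X i ω) ∂P = ∫ x, f x ∂ν := by
  have hint (i : Fin n) : Integrable (fun ω => f (X i ω)) P := by
    rw [← hmap i] at hf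
    exact hf.comp_measurable (hX i)
  have hmean (i : Fin n) : ∫ ω, f (X i ω) ∂P = ∫ x, f x ∂ν := by
    rw [← hmap i] at hf ⊢
    exact (integral_map (hX i).aemeasurable hf.aestronglyMeasurable).symm
  have hn' : (n : ℝ) ≠ 0 := by positivity
  rw [integral_const_mul, integral_finsetSum _ fun i _ => hint i]
  simp [hmean, hn']

/-- the nonnegative estimator R̂¹ₛ(g) of (11) has nonnegative bias,
E[R̂¹ₛ(g)] ≥ R(g) (first part of Proposition 1 of the paper). -/
theorem rAD_estimator1_nonnegative_bias
    {d : ℕ} {Ω : Type*} [MeasurableSpace Ω] (P : Measure Ω) [IsProbabilityMeasure P]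
    (μp μn : Measure (Fin d → ℝ))
    [IsProbabilityMeasure μp] [IsProbabilityMeasure μn]
    (πp πn : ℝ) (hπp : 0 ≤ πp) (hπn : 0 ≤ πn) (hsum : πp + πn = 1)
    (μ : Measure (Fin d → ℝ))
    (hμ : μ = ENNReal.ofReal πp • μp + ENNReal.ofReal πn • μn)
    (ℓp ℓm : ℝ → ℝ) (hℓp : Measurable ℓp) (hℓm : Measurable ℓm)
    (g : (Fin d → ℝ) → ℝ) (hg : Measurable g)
    (np nn nu : ℕ) (hnp : 0 < np) (hnn : 0 < nn) (hnu : 0 < nu)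
    (Xp : Fin np → Ω → (Fin d → ℝ)) (Xn : Fin nn → Ω → (Fin d → ℝ))
    (Xu : Fin nu → Ω → (Fin d → ℝ))
    (hXpm : ∀ i, Measurable (Xp i)) (hXnm : ∀ i, Measurable (Xn i))
    (hXum : ∀ i, Measurable (Xu i))
    (hXp : ∀ i, Measure.map (Xp i) P = μp) (hXn : ∀ i, Measure.map (Xn i) P = μn)
    (hXu : ∀ i, Measure.map (Xu i) P = μ)
    (hint_pp : Integrable (fun x => ℓp (g x)) μp)
    (hint_pm : Integrable (fun x => ℓm (g x)) μp)
    (hint_np : Integrable (fun x => ℓp (g x)) μn)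
    (hint_nm : Integrable (fun x => ℓm (g x)) μn)
    (hint_up : Integrable (fun x => ℓp (g x)) μ)
    (hint_um : Integrable (fun x => ℓm (g x)) μ)
    (a : ℝ) (ha : 0 < a) (ha' : a < 1) :
    ∫ ω, (πn * ((1 / (nn : ℝ)) * ∑ i, ℓm (g (Xn i ω)))
          + (1 - a) * πp * ((1 / (np : ℝ)) * ∑ i, ℓp (g (Xp i ω)))
          + a * max 0 ((1 / (nu : ℝ)) * (∑ i, ℓp (g (Xu i ω)))
              - πn * ((1 / (nn : ℝ)) * ∑ i, ℓp (g (Xn i ω))))) ∂P ≥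
      πp * ∫ x, ℓp (g x) ∂μp + πn * ∫ x, ℓm (g x) ∂μn := by
  have hmix : ∫ x, ℓp (g x) ∂μ = πp * ∫ x, ℓp (g x) ∂μp + πn * ∫ x, ℓp (g x) ∂μn := by
    rw [hμ, integral_add_measure (hint_pp.smul_measure ENNReal.ofReal_ne_top)
      (hint_np.smul_measure ENNReal.ofReal_ne_top), integral_smul_measure, integral_smul_measure,
      ENNReal.toReal_ofReal hπp, ENNReal.toReal_ofReal hπn, smul_eq_mul, smul_eq_mul]
  have hIm := (integrable_sample_mean hXnm hXn hint_nm).const_mul πn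
  have hIp := (integrable_sample_mean hXpm hXp hint_pp).const_mul ((1 - a) * πp)
  have hIu := integrable_sample_mean hXum hXu hint_up
  have hIn := (integrable_sample_mean hXnm hXn hint_np).const_mul πn
  have hID := hIu.sub' hIn
  have hImax := ((integrable_zero Ω ℝ P).sup hID).const_mul a
  have hle := integral_mono hID ((integrable_zero Ω ℝ P).sup hID) fun ω => le_max_right 0 _
  rw [integral_sub hIu hIn, integral_const_mul πn, integral_sample_mean hnu hXum hXu hint_up,
    integral_sample_mean hnn hXnm hXn hint_np, hmix, add_sub_cancel_right] at hle
  refine ge_iff_le.2 (le_of_le_of_eq ?_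
    ((integral_add (hIm.add hIp) hImax).trans
      (congrArg₂ (· + ·) (integral_add hIm hIp) (integral_const_mul a _))).symm)
  rw [integral_const_mul πn, integral_const_mul ((1 - a) * πp),
    integral_sample_mean hnn hXnm hXn hint_nm,
    integral_sample_mean hnp hXpm hXp hint_pp]
  have hscaled := mul_le_mul_of_nonneg_left hle ha.le
  linarith
end

section
/- Suppose X₁ᵖ,…,X_{n_p}ᵖ, X₁ⁿ,…,X_{n_n}ⁿ, X₁ᵘ,…,X_{n_u}ᵘ are ℝ^d-valued random variables with each Xᵢᵖ distributed according to μ_p, each Xᵢⁿ according to μ_n, each Xᵢᵘ according to μ = π_p·μ_p + π_n·μ_n, and that 0 ≤ ℓ₊(g(x)) ≤ C_ℓ and 0 ≤ ℓ₋(g(x)) ≤ C_ℓ for all x ∈ ℝ^d, where C_ℓ > 0. Then for every a ∈ (0,1), the bias of R̂¹_s(g) satisfies E[R̂¹_s(g)] − R(g) ≤ a·π_n·C_ℓ·P(R̂_u⁺(g) − π_n·R̂_n⁺(g) < 0). -/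
open MeasureTheory Finset

theorem integrable_average_comp {Ω E : Type*} [MeasurableSpace Ω] [MeasurableSpace E]
    {P : Measure Ω} {ν : Measure E} {n : ℕ} {X : Fin n → Ω → E}
    (hX : ∀ i, Measurable (X i)) (hν : ∀ i, Measure.map (X i) P = ν)
    {f : E → ℝ} (hf : Integrable f ν) :
    Integrable (fun ω => (1 / (n : ℝ)) * ∑ i, f (X i ω)) P :=
  (integrable_finsetSum _ fun i _ =>
    ((hν i).symm ▸ hf : Integrable f (Measure.map (X i) P)).comp_measurable (hX i)).const_mul _

theorem integral_average_comp {Ω E : Type*} [MeasurableSpace Ω] [MeasurableSpace E]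
    {P : Measure Ω} {ν : Measure E} {n : ℕ} (hn : 0 < n) {X : Fin n → Ω → E}
    (hX : ∀ i, Measurable (X i)) (hν : ∀ i, Measure.map (X i) P = ν)
    {f : E → ℝ} (hf : Integrable f ν) :
    ∫ ω, (1 / (n : ℝ)) * ∑ i, f (X i ω) ∂P = ∫ x, f x ∂ν := by
  have hmap (i : Fin n) : Integrable f (Measure.map (X i) P) := (hν i).symm ▸ hf
  have hint (i : Fin n) : ∫ ω, f (X i ω) ∂P = ∫ x, f x ∂ν := by
    rw [← integral_map (hX i).aemeasurable (hmap i).aestronglyMeasurable, hν i]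
  have hn' : (n : ℝ) ≠ 0 := by positivity
  rw [integral_const_mul, integral_finsetSum (f := fun i ω => f (X i ω)) _
    fun i _ => (hmap i).comp_measurable (hX i)]
  simp [hint, hn']

theorem average_le {n : ℕ} (hn : 0 < n) {f : Fin n → ℝ} {C : ℝ} (hf : ∀ i, f i ≤ C) :
    (1 / (n : ℝ)) * ∑ i, f i ≤ C := by
  have hn' : (0 : ℝ) < n := by positivity
  have h := Finset.sum_le_card_nsmul Finset.univ f C fun i _ => hf i
  rw [one_div, inv_mul_le_iff₀ hn']
  simpa using h

theorem max_zero_le_add_indicator {α : Type*} {f : α → ℝ} {c : ℝ} (hf : ∀ x, -c ≤ f x) (x : α) :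
    max 0 (f x) ≤ f x + {y | f y < 0}.indicator (fun _ => c) x := by
  by_cases h : f x < 0
  · rw [Set.indicator_of_mem (by exact h), max_eq_left h.le]
    linarith [hf x]
  · rw [Set.indicator_of_notMem (by exact h), max_eq_right (not_lt.mp h), add_zero]

/-- bound on the bias of the nonnegative estimator R̂¹ₛ(g):
E[R̂¹ₛ(g)] − R(g) ≤ a·π_n·C_ℓ·P(R̂_u⁺(g) − π_n·R̂_n⁺(g) < 0). -/
theorem rAD_estimator1_bias_bound
    {d : ℕ} {Ω : Type*} [MeasurableSpace Ω] (P : Measure Ω) [IsProbabilityMeasure P]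
    (μp μn : Measure (Fin d → ℝ))
    [IsProbabilityMeasure μp] [IsProbabilityMeasure μn]
    (πp πn : ℝ) (hπp : 0 ≤ πp) (hπn : 0 ≤ πn) (hsum : πp + πn = 1)
    (μ : Measure (Fin d → ℝ))
    (hμ : μ = ENNReal.ofReal πp • μp + ENNReal.ofReal πn • μn)
    (ℓp ℓm : ℝ → ℝ) (hℓp : Measurable ℓp) (hℓm : Measurable ℓm)
    (g : (Fin d → ℝ) → ℝ) (hg : Measurable g)
    (Cℓ : ℝ) (hCℓ : 0 < Cℓ)
    (hbdd_p : ∀ x : Fin d → ℝ, 0 ≤ ℓp (g x) ∧ ℓp (g x) ≤ Cℓ)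
    (hbdd_m : ∀ x : Fin d → ℝ, 0 ≤ ℓm (g x) ∧ ℓm (g x) ≤ Cℓ)
    (np nn nu : ℕ) (hnp : 0 < np) (hnn : 0 < nn) (hnu : 0 < nu)
    (Xp : Fin np → Ω → (Fin d → ℝ)) (Xn : Fin nn → Ω → (Fin d → ℝ))
    (Xu : Fin nu → Ω → (Fin d → ℝ))
    (hXpm : ∀ i, Measurable (Xp i)) (hXnm : ∀ i, Measurable (Xn i))
    (hXum : ∀ i, Measurable (Xu i))
    (hXp : ∀ i, Measure.map (Xp i) P = μp) (hXn : ∀ i, Measure.map (Xn i) P = μn)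
    (hXu : ∀ i, Measure.map (Xu i) P = μ)
    (a : ℝ) (ha : 0 < a) (ha' : a < 1) :
    (∫ ω, (πn * ((1 / (nn : ℝ)) * ∑ i, ℓm (g (Xn i ω)))
          + (1 - a) * πp * ((1 / (np : ℝ)) * ∑ i, ℓp (g (Xp i ω)))
          + a * max 0 ((1 / (nu : ℝ)) * (∑ i, ℓp (g (Xu i ω)))
              - πn * ((1 / (nn : ℝ)) * ∑ i, ℓp (g (Xn i ω))))) ∂P)
      - (πp * ∫ x, ℓp (g x) ∂μp + πn * ∫ x, ℓm (g x) ∂μn) ≤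
      a * πn * Cℓ *
        (P {ω | (1 / (nu : ℝ)) * (∑ i, ℓp (g (Xu i ω)))
            - πn * ((1 / (nn : ℝ)) * ∑ i, ℓp (g (Xn i ω))) < 0}).toReal := by
  subst hμ
  have hint (ν : Measure (Fin d → ℝ)) [IsFiniteMeasure ν] {l : ℝ → ℝ} (hl : Measurable l)
      (hb : ∀ x, 0 ≤ l (g x) ∧ l (g x) ≤ Cℓ) : Integrable (fun x => l (g x)) ν :=
    .of_bound (hl.comp hg).aestronglyMeasurable Cℓ <| .of_forall fun x => by
      rw [Real.norm_of_nonneg (hb x).1]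
      exact (hb x).2
  have hIpp := hint μp hℓp hbdd_p
  have hIpn := hint μn hℓp hbdd_p
  have hImn := hint μn hℓm hbdd_m
  have hIp := hIpp.smul_measure (c := ENNReal.ofReal πp) ENNReal.ofReal_ne_top
  have hIn := hIpn.smul_measure (c := ENNReal.ofReal πn) ENNReal.ofReal_ne_top
  have hIu := hIp.add_measure hIn
  have hRu := integral_average_comp hnu hXum hXu hIu
  rw [integral_add_measure hIp hIn, integral_smul_measure, integral_smul_measure,
    ENNReal.toReal_ofReal hπp, ENNReal.toReal_ofReal hπn, smul_eq_mul, smul_eq_mul] at hRu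
  have hRpp := integral_average_comp hnp hXpm hXp hIpp
  have hRnp := integral_average_comp hnn hXnm hXn hIpn
  have hRnm := integral_average_comp hnn hXnm hXn hImn
  have hJu := integrable_average_comp hXum hXu hIu
  have hJpp := integrable_average_comp hXpm hXp hIpp
  have hJnp := integrable_average_comp hXnm hXn hIpn
  have hJnm := integrable_average_comp hXnm hXn hImn
  set Z : Ω → ℝ := fun ω => (1 / (nu : ℝ)) * (∑ i, ℓp (g (Xu i ω)))
    - πn * ((1 / (nn : ℝ)) * ∑ i, ℓp (g (Xn i ω))) with hZ
  have hJZ : Integrable Z P := hJu.sub (hJnp.const_mul πn)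
  have hZint : ∫ ω, Z ω ∂P = πp * ∫ x, ℓp (g x) ∂μp := by
    rw [hZ, integral_sub hJu (hJnp.const_mul πn), hRu, integral_const_mul πn, hRnp]
    ring
  have hlower (ω : Ω) : -(πn * Cℓ) ≤ Z ω := by
    have h₁ : 0 ≤ (1 / (nu : ℝ)) * ∑ i, ℓp (g (Xu i ω)) :=
      mul_nonneg (by positivity) (Finset.sum_nonneg fun i _ => (hbdd_p _).1)
    have h₂ := mul_le_mul_of_nonneg_left (average_le hnn fun i => (hbdd_p (Xn i ω)).2) hπn
    simp only [hZ]
    linarith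
  have hset : MeasurableSet {ω | Z ω < 0} := by
    refine measurableSet_lt ?_ measurable_const
    fun_prop
  have hJind : Integrable ({ω | Z ω < 0}.indicator fun _ => πn * Cℓ) P :=
    (integrable_const _).indicator hset
  have hJmax : Integrable (fun ω => max 0 (Z ω)) P := (integrable_zero _ _ _).sup hJZ
  have hmax : ∫ ω, max 0 (Z ω) ∂P
      ≤ πp * ∫ x, ℓp (g x) ∂μp + πn * Cℓ * (P {ω | Z ω < 0}).toReal := by
    calc ∫ ω, max 0 (Z ω) ∂P
        ≤ ∫ ω, (Z ω + {ω | Z ω < 0}.indicator (fun _ => πn * Cℓ) ω) ∂P :=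
          integral_mono hJmax (hJZ.add hJind) (max_zero_le_add_indicator hlower)
      _ = πp * ∫ x, ℓp (g x) ∂μp + πn * Cℓ * (P {ω | Z ω < 0}).toReal := by
          rw [integral_add hJZ hJind, hZint, integral_indicator_const _ hset, smul_eq_mul,
            mul_comm (P.real _), Measure.real]
  set A : Ω → ℝ := fun ω => (1 / (nn : ℝ)) * ∑ i, ℓm (g (Xn i ω))
  set B : Ω → ℝ := fun ω => (1 / (np : ℝ)) * ∑ i, ℓp (g (Xp i ω))
  have hJAB : Integrable (fun ω => πn * A ω + (1 - a) * πp * B ω) P :=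
    (hJnm.const_mul πn).add (hJpp.const_mul _)
  change (∫ ω, (πn * A ω + (1 - a) * πp * B ω + a * max 0 (Z ω)) ∂P) - _
    ≤ a * πn * Cℓ * (P {ω | Z ω < 0}).toReal
  rw [integral_add hJAB (hJmax.const_mul a),
    integral_add (hJnm.const_mul πn) (hJpp.const_mul _), integral_const_mul πn,
    integral_const_mul ((1 - a) * πp), integral_const_mul a, hRnm, hRpp]
  linarith [mul_le_mul_of_nonneg_left hmax ha.le]
end
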